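/- arXiv:1605.03210 — 6 statements merged into one kernel-verified Lean document; each statement's English description precedes it below -/
import Mathlib

section
/- Let (X,d) be a metric space, f : X → X a continuous map, K ⊆ X a compact set and α ≥ 0. Then the estimation entropy defined via finite sets of approximating functions equals the value defined via spanning sets: lim_{ε↓0} limsup_{n→∞} (1/n)·log₂ s_est(n,ε,α,K) = lim_{ε↓0} limsup_{n→∞} (1/n)·log₂ s*_est(n,ε,α,K). -/
open Filter Metric Set

/-- Minimal cardinality of an `(n,ε,α,K)`-approximating set: a finite set of
functions `g : ℕ → X` (regarded as functions on `{0,…,n}`) such that every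
`x ∈ K` is `ε·e^{-αt}`-approximated by some `g` for all integer times `0 ≤ t ≤ n`. -/
noncomputable def approxNum {X : Type*} [MetricSpace X] (f : X → X) (K : Set X)
    (α : ℝ) (n : ℕ) (ε : ℝ) : ℕ :=
  sInf {m : ℕ | ∃ F : Finset (ℕ → X), F.card = m ∧
    ∀ x ∈ K, ∃ g ∈ F, ∀ t : ℕ, t ≤ n →
      dist (f^[t] x) (g t) < ε * Real.exp (-α * t)}

/-- Minimal cardinality of an `(n,ε,α,K)`-spanning set for `f`. -/
noncomputable def spanNum {X : Type*} [MetricSpace X] (f : X → X) (K : Set X)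
    (α : ℝ) (n : ℕ) (ε : ℝ) : ℕ :=
  sInf {m : ℕ | ∃ S : Finset X, ↑S ⊆ K ∧ S.card = m ∧
    ∀ x ∈ K, ∃ y ∈ S, ∀ t : ℕ, t ≤ n →
      dist (f^[t] x) (f^[t] y) < ε * Real.exp (-α * t)}

/-- Estimation entropy via approximating sets of functions (base-2 logarithm);
the limit as `ε ↓ 0` is realized as the supremum over `ε > 0`, by monotonicity. -/
noncomputable def estEntropyApprox {X : Type*} [MetricSpace X] (f : X → X) (K : Set X)
    (α : ℝ) : EReal :=
  ⨆ ε ∈ Set.Ioi (0 : ℝ),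
    atTop.limsup fun n : ℕ => ((Real.logb 2 (approxNum f K α n ε) / n : ℝ) : EReal)

/-- Estimation entropy via spanning sets (base-2 logarithm). -/
noncomputable def estEntropySpan {X : Type*} [MetricSpace X] (f : X → X) (K : Set X)
    (α : ℝ) : EReal :=
  ⨆ ε ∈ Set.Ioi (0 : ℝ),
    atTop.limsup fun n : ℕ => ((Real.logb 2 (spanNum f K α n ε) / n : ℝ) : EReal)

theorem approxNum_le_card {X : Type*} [MetricSpace X] {f : X → X} {K : Set X} {α : ℝ} {n : ℕ}
    {ε : ℝ} (F : Finset (ℕ → X))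
    (hF : ∀ x ∈ K, ∃ g ∈ F, ∀ t : ℕ, t ≤ n → dist (f^[t] x) (g t) < ε * Real.exp (-α * t)) :
    approxNum f K α n ε ≤ F.card :=
  Nat.sInf_le ⟨F, rfl, hF⟩

theorem spanNum_le_card {X : Type*} [MetricSpace X] {f : X → X} {K : Set X} {α : ℝ} {n : ℕ}
    {ε : ℝ} (S : Finset X) (hSK : ↑S ⊆ K)
    (hS : ∀ x ∈ K, ∃ y ∈ S, ∀ t : ℕ, t ≤ n →
      dist (f^[t] x) (f^[t] y) < ε * Real.exp (-α * t)) :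
    spanNum f K α n ε ≤ S.card :=
  Nat.sInf_le ⟨S, hSK, rfl, hS⟩

theorem exists_finset_spanning {X : Type*} [MetricSpace X] {f : X → X} (hf : Continuous f)
    {K : Set X} (hK : IsCompact K) (α : ℝ) (n : ℕ) {ε : ℝ} (hε : 0 < ε) :
    ∃ S : Finset X, ↑S ⊆ K ∧ ∀ x ∈ K, ∃ y ∈ S, ∀ t : ℕ, t ≤ n →
      dist (f^[t] x) (f^[t] y) < ε * Real.exp (-α * t) := by
  obtain ⟨S, hSK, hS⟩ := hK.elim_nhds_subcover
    (fun y => {x | ∀ t ∈ Set.Iic n, dist (f^[t] x) (f^[t] y) < ε * Real.exp (-α * t)}) (by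
      intro y _
      refine (eventually_all_finite (Set.finite_Iic n)).2 fun t _ => ?_
      refine ((hf.iterate t).dist continuous_const).continuousAt.eventually_lt_const ?_
      simpa only [dist_self] using mul_pos hε (Real.exp_pos _))
  refine ⟨S, hSK, fun x hx => ?_⟩
  obtain ⟨y, hy, hxy⟩ := Set.mem_iUnion₂.1 (hS hx)
  exact ⟨y, hy, hxy⟩

theorem exists_finset_approximating_of_spanning {X : Type*} [MetricSpace X] (f : X → X) (K : Set X)
    (α : ℝ) (n : ℕ) (ε : ℝ) (S : Finset X)
    (hS : ∀ x ∈ K, ∃ y ∈ S, ∀ t : ℕ, t ≤ n →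
      dist (f^[t] x) (f^[t] y) < ε * Real.exp (-α * t)) :
    ∃ F : Finset (ℕ → X), F.card ≤ S.card ∧ ∀ x ∈ K, ∃ g ∈ F, ∀ t : ℕ, t ≤ n →
      dist (f^[t] x) (g t) < ε * Real.exp (-α * t) := by
  classical
  refine ⟨S.image fun y t => f^[t] y, Finset.card_image_le, fun x hx => ?_⟩
  obtain ⟨y, hy, hxy⟩ := hS x hx
  exact ⟨_, Finset.mem_image_of_mem _ hy, hxy⟩

theorem approxNum_le_spanNum {X : Type*} [MetricSpace X] {f : X → X} (hf : Continuous f)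
    {K : Set X} (hK : IsCompact K) (α : ℝ) (n : ℕ) {ε : ℝ} (hε : 0 < ε) :
    approxNum f K α n ε ≤ spanNum f K α n ε := by
  obtain ⟨S₀, hS₀K, hS₀⟩ := exists_finset_spanning hf hK α n hε
  obtain ⟨S, -, hcard, hS⟩ : spanNum f K α n ε ∈ _ := Nat.sInf_mem ⟨_, S₀, hS₀K, rfl, hS₀⟩
  obtain ⟨F, hFS, hF⟩ := exists_finset_approximating_of_spanning f K α n ε S hS
  exact (approxNum_le_card F hF).trans (hFS.trans hcard.le)

theorem spanNum_two_mul_le_approxNum {X : Type*} [MetricSpace X] {f : X → X} (hf : Continuous f)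
    {K : Set X} (hK : IsCompact K) (α : ℝ) (n : ℕ) {ε : ℝ} (hε : 0 < ε) :
    spanNum f K α n (2 * ε) ≤ approxNum f K α n ε := by
  classical
  obtain ⟨S₀, -, hS₀⟩ := exists_finset_spanning hf hK α n hε
  obtain ⟨F₀, -, hF₀⟩ := exists_finset_approximating_of_spanning f K α n ε S₀ hS₀
  obtain ⟨F, hcard, hF⟩ : approxNum f K α n ε ∈ _ := Nat.sInf_mem ⟨_, F₀, rfl, hF₀⟩
  obtain rfl | ⟨x₀, hx₀⟩ := K.eq_empty_or_nonempty
  · exact (spanNum_le_card ∅ (by simp) (by simp)).trans (Nat.zero_le _)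
  have hc : ∀ g : ℕ → X, ∃ y ∈ K, ∀ x ∈ K,
      (∀ t : ℕ, t ≤ n → dist (f^[t] x) (g t) < ε * Real.exp (-α * t)) →
      ∀ t : ℕ, t ≤ n → dist (f^[t] y) (g t) < ε * Real.exp (-α * t) := by
    intro g
    by_cases h : ∃ y ∈ K, ∀ t : ℕ, t ≤ n → dist (f^[t] y) (g t) < ε * Real.exp (-α * t)
    · obtain ⟨y, hy, hyg⟩ := h
      exact ⟨y, hy, fun _ _ _ => hyg⟩
    · exact ⟨x₀, hx₀, fun x hx hxg => absurd ⟨x, hx, hxg⟩ h⟩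
  choose c hcK hcg using hc
  refine (spanNum_le_card (F.image c) ?_ fun x hx => ?_).trans
    (Finset.card_image_le.trans hcard.le)
  · intro y hy
    obtain ⟨g, -, rfl⟩ := Finset.mem_image.1 (Finset.mem_coe.1 hy)
    exact hcK g
  · obtain ⟨g, hg, hxg⟩ := hF x hx
    refine ⟨c g, Finset.mem_image_of_mem c hg, fun t ht => ?_⟩
    linarith [dist_triangle_right (f^[t] x) (f^[t] (c g)) (g t), hxg t ht, hcg g x hx hxg t ht]

theorem Real.monotone_log_natCast : Monotone fun n : ℕ => Real.log n := by
  intro m n h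
  obtain rfl | hm := m.eq_zero_or_pos
  · simpa using Real.log_natCast_nonneg n
  · exact Real.log_le_log (by exact_mod_cast hm) (by exact_mod_cast h)

theorem limsup_logb_div_le {a b : ℕ → ℕ} (h : ∀ n, a n ≤ b n) :
    (atTop.limsup fun n : ℕ => ((Real.logb 2 (a n) / n : ℝ) : EReal)) ≤
      atTop.limsup fun n : ℕ => ((Real.logb 2 (b n) / n : ℝ) : EReal) := by
  refine limsup_le_limsup (Eventually.of_forall fun n => EReal.coe_le_coe_iff.2 ?_)
  refine div_le_div_of_nonneg_right ?_ (Nat.cast_nonneg n)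
  exact div_le_div_of_nonneg_right (Real.monotone_log_natCast (h n)) (Real.log_nonneg one_le_two)

/-- For a continuous map `f` on a metric space, a compact set `K` and
`α ≥ 0`, the estimation entropy defined via finite sets of approximating functions
equals the one defined via spanning sets. -/
theorem estimation_entropy_approx_eq_span {X : Type*} [MetricSpace X]
    (f : X → X) (hf : Continuous f) (K : Set X) (hK : IsCompact K)
    (α : ℝ) (hα : 0 ≤ α) :
    estEntropyApprox f K α = estEntropySpan f K α := by
  refine le_antisymm (iSup₂_mono fun ε hε => ?_) (iSup₂_le fun ε hε => ?_)
  · exact limsup_logb_div_le fun n => approxNum_le_spanNum hf hK α n hε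
  · have hε₂ : 0 < ε / 2 := half_pos hε
    refine le_iSup₂_of_le (ε / 2) hε₂ (limsup_logb_div_le fun n => ?_)
    have h := spanNum_two_mul_le_approxNum hf hK α n hε₂
    rwa [mul_div_cancel₀ ε two_ne_zero] at h
end

section
/- Consider the semiflow φ_t(x) = e^{−t}·x on X = [0,∞) equipped with the metric d(x,y) = |x − y|, and let K = [0,1] and α = 2. Then the continuous-time estimation entropy satisfies h_est(2,K;φ) = 1. -/
open Filter Metric Set

/-- Minimal cardinality of a `(T,ε,α,K)`-spanning set for the semiflow `φ`,
with respect to the distance function `d`. -/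
noncomputable def spanNumFlow {X : Type*} (d : X → X → ℝ) (φ : ℝ → X → X) (K : Set X)
    (α : ℝ) (T : ℝ) (ε : ℝ) : ℕ :=
  sInf {m : ℕ | ∃ S : Finset X, ↑S ⊆ K ∧ S.card = m ∧
    ∀ x ∈ K, ∃ y ∈ S, ∀ t : ℝ, 0 ≤ t → t ≤ T →
      d (φ t x) (φ t y) < ε * Real.exp (-α * t)}

/-- Continuous-time estimation entropy (natural logarithm); the limit as `ε ↓ 0`
is realized as the supremum over `ε > 0`, by monotonicity. -/
noncomputable def estEntropyFlow {X : Type*} (d : X → X → ℝ) (φ : ℝ → X → X)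
    (K : Set X) (α : ℝ) : EReal :=
  ⨆ ε ∈ Set.Ioi (0 : ℝ),
    atTop.limsup fun T : ℝ => ((Real.log (spanNumFlow d φ K α T ε) / T : ℝ) : EReal)

namespace LinearFlowEntropy

/-- The spanning condition for `e^{-t}·x` only matters at the final time. -/
lemma forall_flow_dist_lt_iff {T ε x y : ℝ} (hT : 0 ≤ T) (hε : 0 < ε) :
    (∀ t : ℝ, 0 ≤ t → t ≤ T →
      |Real.exp (-t) * x - Real.exp (-t) * y| < ε * Real.exp (-2 * t)) ↔
      |x - y| < ε * Real.exp (-T) := by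
  have key (t : ℝ) : |Real.exp (-t) * x - Real.exp (-t) * y| < ε * Real.exp (-2 * t) ↔
      |x - y| < ε * Real.exp (-t) := by
    have h : Real.exp (-2 * t) = Real.exp (-t) * Real.exp (-t) := by
      rw [← Real.exp_add]; ring_nf
    rw [← mul_sub, abs_mul, abs_of_pos (Real.exp_pos _), h, mul_left_comm]
    exact mul_lt_mul_iff_right₀ (Real.exp_pos _)
  simp only [key]
  refine ⟨fun h => h T hT le_rfl, fun h t _ htT => h.trans_le ?_⟩
  gcongr

/-- The unit interval has an `r`-net with at most `1 / r + 2` points. -/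
lemma exists_finset_net_Icc {r : ℝ} (hr : 0 < r) :
    ∃ S : Finset ℝ, (S : Set ℝ) ⊆ Set.Icc 0 1 ∧ (S.card : ℝ) ≤ 1 / r + 2 ∧
      ∀ x ∈ Set.Icc (0 : ℝ) 1, ∃ y ∈ S, |x - y| < r := by
  classical
  have hn : 0 < ⌈1 / r⌉₊ := Nat.ceil_pos.2 (by positivity)
  set n := ⌈1 / r⌉₊ with hndef
  have hn' : (0 : ℝ) < n := by exact_mod_cast hn
  refine ⟨(Finset.range (n + 1)).image fun k : ℕ => (k : ℝ) / n, ?_, ?_, ?_⟩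
  · intro y hy
    simp only [Finset.coe_image, Finset.coe_range, Set.mem_image, Set.mem_Iio] at hy
    obtain ⟨k, hk, rfl⟩ := hy
    refine ⟨by positivity, (div_le_one hn').2 ?_⟩
    exact_mod_cast Nat.lt_succ_iff.1 hk
  · have h1 : ((Finset.range (n + 1)).image fun k : ℕ => (k : ℝ) / n).card ≤ n + 1 :=
      Finset.card_image_le.trans (by simp)
    have h2 : (n : ℝ) < 1 / r + 1 := Nat.ceil_lt_add_one (by positivity)
    have h3 : (((Finset.range (n + 1)).image fun k : ℕ => (k : ℝ) / n).card : ℝ) ≤ n + 1 := by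
      exact_mod_cast h1
    linarith
  · rintro x ⟨hx0, hx1⟩
    have hxn : 0 ≤ x * n := by positivity
    refine ⟨(⌊x * n⌋₊ : ℝ) / n, Finset.mem_image.2 ⟨⌊x * n⌋₊, ?_, rfl⟩, ?_⟩
    · rw [Finset.mem_range, Nat.lt_succ_iff]
      exact Nat.floor_le_of_le (by nlinarith)
    · have h1 := Nat.floor_le hxn
      have h2 := Nat.lt_floor_add_one (x * n)
      have h3 : 1 / r ≤ n := Nat.le_ceil _
      have h4 : x - (⌊x * n⌋₊ : ℝ) / n = (x * n - ⌊x * n⌋₊) / n := by field_simp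
      have h5 : 1 ≤ r * n := by rwa [div_le_iff₀' hr] at h3
      rw [h4, abs_of_nonneg (div_nonneg (by linarith) hn'.le), div_lt_iff₀ hn']
      linarith

/-- An `r`-net of the unit interval has at least `1 / (2 r)` points. -/
lemma one_le_card_mul_of_net_Icc {r : ℝ} (hr : 0 < r) {S : Finset ℝ}
    (hS : ∀ x ∈ Set.Icc (0 : ℝ) 1, ∃ y ∈ S, |x - y| < r) : 1 ≤ (S.card : ℝ) * (2 * r) := by
  have hsub : Set.Icc (0 : ℝ) 1 ⊆ ⋃ y ∈ S, Metric.ball y r := by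
    intro x hx
    obtain ⟨y, hy, hxy⟩ := hS x hx
    exact Set.mem_biUnion hy (by rwa [Metric.mem_ball, Real.dist_eq])
  have h := (MeasureTheory.measure_mono (μ := MeasureTheory.volume) hsub).trans
    (MeasureTheory.measure_biUnion_finset_le S _)
  simp only [Real.volume_Icc, Real.volume_ball, Finset.sum_const, nsmul_eq_mul, sub_zero] at h
  rw [← ENNReal.ofReal_natCast, ← ENNReal.ofReal_mul (by positivity)] at h
  exact (ENNReal.ofReal_le_ofReal_iff (by positivity)).1 h

lemma spanNumFlow_bounds {T ε : ℝ} (hT : 0 ≤ T) (hε : 0 < ε) :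
    Real.exp T / (2 * ε) ≤ spanNumFlow (fun x y : ℝ => |x - y|)
        (fun t x => Real.exp (-t) * x) (Set.Icc (0 : ℝ) 1) 2 T ε ∧
      (spanNumFlow (fun x y : ℝ => |x - y|)
        (fun t x => Real.exp (-t) * x) (Set.Icc (0 : ℝ) 1) 2 T ε : ℝ) ≤
        (1 / ε + 2) * Real.exp T := by
  have hr : 0 < ε * Real.exp (-T) := by positivity
  unfold spanNumFlow
  simp only [forall_flow_dist_lt_iff hT hε]
  obtain ⟨S, hSK, hcard, hS⟩ := exists_finset_net_Icc hr
  have hmem : S.card ∈ {m : ℕ | ∃ S : Finset ℝ, ↑S ⊆ Set.Icc (0 : ℝ) 1 ∧ S.card = m ∧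
      ∀ x ∈ Set.Icc (0 : ℝ) 1, ∃ y ∈ S, |x - y| < ε * Real.exp (-T)} := ⟨S, hSK, rfl, hS⟩
  constructor
  · obtain ⟨S', -, hcard', hS'⟩ := Nat.sInf_mem ⟨_, hmem⟩
    rw [← hcard', div_le_iff₀ (by positivity)]
    have h := one_le_card_mul_of_net_Icc hr hS'
    rw [Real.exp_neg] at h
    have he := Real.exp_pos T
    field_simp at h
    linarith
  · refine (Nat.cast_le.2 (Nat.sInf_le hmem)).trans (hcard.trans ?_)
    have h1 : 1 / (ε * Real.exp (-T)) = 1 / ε * Real.exp T := by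
      rw [Real.exp_neg]; field_simp
    have h2 := Real.one_le_exp hT
    rw [h1, add_mul]
    linarith

/-- A quantity within constant factors of `e^T` has exponential growth rate `1`. -/
lemma tendsto_log_div_of_bounds {f : ℝ → ℝ} {a b : ℝ} (ha : 0 < a)
    (hl : ∀ T, 0 ≤ T → a * Real.exp T ≤ f T) (hu : ∀ T, 0 ≤ T → f T ≤ b * Real.exp T) :
    Tendsto (fun T => Real.log (f T) / T) atTop (nhds 1) := by
  have hb : 0 < b := by
    have := (hl 0 le_rfl).trans (hu 0 le_rfl)
    simp only [Real.exp_zero, mul_one] at this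
    linarith
  have lim (c : ℝ) : Tendsto (fun T : ℝ => Real.log c / T + 1) atTop (nhds 1) := by
    simpa using (tendsto_const_nhds (x := Real.log c)).div_atTop tendsto_id |>.add_const 1
  have hlog {c T : ℝ} (hc : 0 < c) (hT : 0 < T) :
      Real.log c / T + 1 = Real.log (c * Real.exp T) / T := by
    rw [Real.log_mul hc.ne' (Real.exp_ne_zero _), Real.log_exp]
    field_simp
  refine tendsto_of_tendsto_of_tendsto_of_le_of_le' (lim a) (lim b) ?_ ?_
  · filter_upwards [eventually_gt_atTop 0] with T hT
    rw [hlog ha hT]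
    gcongr
    exact hl T hT.le
  · filter_upwards [eventually_gt_atTop 0] with T hT
    rw [hlog hb hT]
    have := (mul_pos ha (Real.exp_pos T)).trans_le (hl T hT.le)
    gcongr
    exact hu T hT.le

end LinearFlowEntropy

/-- For the semiflow `φ_t(x) = e^{-t}·x` on `[0,∞)` with the metric
`d(x,y) = |x - y|`, the compact set `K = [0,1]` and `α = 2`, the continuous-time
estimation entropy equals `1`. (Everything takes place inside `K = [0,1] ⊆ ℝ`.) -/
theorem estimation_entropy_linear_flow_std_metric :
    estEntropyFlow (fun x y : ℝ => |x - y|) (fun t x => Real.exp (-t) * x)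
      (Set.Icc (0 : ℝ) 1) 2 = (1 : EReal) := by
  have key : ∀ ε ∈ Set.Ioi (0 : ℝ), atTop.limsup (fun T : ℝ =>
      ((Real.log (spanNumFlow (fun x y : ℝ => |x - y|) (fun t x => Real.exp (-t) * x)
        (Set.Icc (0 : ℝ) 1) 2 T ε) / T : ℝ) : EReal)) = 1 := by
    intro ε hε
    have hε' : 0 < ε := hε
    have h := LinearFlowEntropy.tendsto_log_div_of_bounds (a := 1 / (2 * ε)) (b := 1 / ε + 2)
      (by positivity)
      (fun T hT => by
        rw [one_div_mul_eq_div]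
        exact (LinearFlowEntropy.spanNumFlow_bounds hT hε').1)
      (fun T hT => (LinearFlowEntropy.spanNumFlow_bounds hT hε').2)
    exact ((continuous_coe_real_ereal.tendsto 1).comp h).limsup_eq
  unfold estEntropyFlow
  rw [biSup_congr key]
  exact biSup_const Set.nonempty_Ioi
end

section
/- Consider the semiflow φ_t(x) = e^{−t}·x on X = [0,∞) equipped with the metric d′(x,y) = |√x − √y|, and let K = [0,1] and α = 2. Then the continuous-time estimation entropy satisfies h_est(2,K;φ) = 3/2. -/
open Filter Metric Set

/-- A `δ`-net of `[0,1]` for the metric `|√x - √y|` has at least `1 / (2δ)` points. -/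
theorem one_le_card_mul_of_sqrt_net {S : Finset ℝ} {δ : ℝ} (hδ : 0 < δ)
    (hS : ∀ x ∈ Icc (0 : ℝ) 1, ∃ y ∈ S, |√x - √y| < δ) : 1 ≤ S.card * (2 * δ) := by
  have hsub : Icc (0 : ℝ) 1 ⊆ ⋃ y ∈ S, ball (√y) δ := by
    intro u hu
    obtain ⟨y, hy, h⟩ := hS (u ^ 2) ⟨by positivity, pow_le_one₀ hu.1 hu.2⟩
    rw [Real.sqrt_sq hu.1] at h
    simp only [mem_iUnion]
    exact ⟨y, hy, h⟩
  have h := (MeasureTheory.measure_mono (μ := MeasureTheory.volume) hsub).trans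
    (MeasureTheory.measure_biUnion_finset_le S _)
  simp only [Real.volume_Icc, Real.volume_ball, Finset.sum_const, nsmul_eq_mul] at h
  rw [← ENNReal.ofReal_natCast, ← ENNReal.ofReal_mul (by positivity),
    ENNReal.ofReal_le_ofReal_iff (by positivity)] at h
  linarith

/-- `[0,1]` has a `δ`-net with at most `1 / δ + 2` points for the metric `|√x - √y|`. -/
theorem exists_sqrt_net {δ : ℝ} (hδ : 0 < δ) :
    ∃ S : Finset ℝ, ↑S ⊆ Icc (0 : ℝ) 1 ∧ (S.card : ℝ) ≤ 1 / δ + 2 ∧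
      ∀ x ∈ Icc (0 : ℝ) 1, ∃ y ∈ S, |√x - √y| < δ := by
  set M : ℕ := ⌊1 / δ⌋₊ + 1 with hM
  have hM0 : (0 : ℝ) < M := by rw [hM]; positivity
  have hMδ : 1 / δ < M := by
    rw [hM]; push_cast; exact Nat.lt_floor_add_one _
  have hMle : (M : ℝ) ≤ 1 / δ + 1 := by
    have := Nat.floor_le (show 0 ≤ 1 / δ by positivity)
    rw [hM]; push_cast; linarith
  refine ⟨(Finset.range (M + 1)).image fun k : ℕ => ((k : ℝ) / M) ^ 2, ?_, ?_, ?_⟩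
  · intro y hy
    simp only [Finset.coe_image, mem_image, Finset.coe_range, mem_Iio] at hy
    obtain ⟨k, hk, rfl⟩ := hy
    refine ⟨by positivity, pow_le_one₀ (by positivity) ?_⟩
    rw [div_le_one hM0]
    exact_mod_cast Nat.lt_succ_iff.mp hk
  · have h : ((Finset.range (M + 1)).image fun k : ℕ => ((k : ℝ) / M) ^ 2).card ≤ M + 1 :=
      Finset.card_image_le.trans (by simp)
    have h' := (Nat.cast_le (α := ℝ)).mpr h
    push_cast at h'
    linarith
  · intro x hx
    have hx1 : √x ≤ 1 := Real.sqrt_le_one.mpr hx.2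
    have hnn : 0 ≤ √x * M := by positivity
    refine ⟨((⌊√x * M⌋₊ : ℝ) / M) ^ 2, ?_, ?_⟩
    · refine Finset.mem_image.mpr ⟨_, ?_, rfl⟩
      rw [Finset.mem_range, Nat.lt_succ_iff]
      exact Nat.floor_le_of_le (by nlinarith)
    · rw [Real.sqrt_sq (by positivity)]
      have h1 := Nat.floor_le hnn
      have h2 := Nat.lt_floor_add_one (√x * M)
      have h3 : √x - (⌊√x * M⌋₊ : ℝ) / M = (√x * M - ⌊√x * M⌋₊) / M := by field_simp
      have h4 : 1 < δ * M := by rwa [div_lt_iff₀' hδ] at hMδ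
      rw [h3, abs_of_nonneg (by apply div_nonneg <;> linarith), div_lt_iff₀ hM0]
      linarith

theorem sqrt_dist_lt_on_Icc_iff {T : ℝ} (hT : 0 ≤ T) {ε : ℝ} (hε : 0 < ε) (x y : ℝ) :
    (∀ t : ℝ, 0 ≤ t → t ≤ T →
      |√(Real.exp (-t) * x) - √(Real.exp (-t) * y)| < ε * Real.exp (-2 * t)) ↔
    |√x - √y| < ε * Real.exp (-(3 / 2 * T)) := by
  have key (t : ℝ) : |√(Real.exp (-t) * x) - √(Real.exp (-t) * y)| < ε * Real.exp (-2 * t) ↔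
      |√x - √y| < ε * Real.exp (-(3 / 2 * t)) := by
    have h : Real.exp (-2 * t) = Real.exp (-t / 2) * Real.exp (-(3 / 2 * t)) := by
      rw [← Real.exp_add]; ring_nf
    rw [Real.sqrt_mul (Real.exp_pos _).le, Real.sqrt_mul (Real.exp_pos _).le, ← Real.exp_half,
      ← mul_sub, abs_mul, abs_of_pos (Real.exp_pos _), h, mul_left_comm,
      mul_lt_mul_iff_right₀ (Real.exp_pos _)]
  simp only [key]
  refine ⟨fun h => h T hT le_rfl, fun h t _ htT => h.trans_le ?_⟩
  gcongr

theorem spanNumFlow_sqrt_bounds {T : ℝ} (hT : 0 ≤ T) {ε : ℝ} (hε : 0 < ε) :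
    1 / (2 * ε) * Real.exp (3 / 2 * T) ≤
        spanNumFlow (fun x y : ℝ => |√x - √y|) (fun t x => Real.exp (-t) * x) (Icc 0 1) 2 T ε ∧
      (spanNumFlow (fun x y : ℝ => |√x - √y|) (fun t x => Real.exp (-t) * x) (Icc 0 1) 2 T ε : ℝ)
        ≤ (1 / ε + 2) * Real.exp (3 / 2 * T) := by
  have hδ : 0 < ε * Real.exp (-(3 / 2 * T)) := by positivity
  have hexp : 1 ≤ Real.exp (3 / 2 * T) := Real.one_le_exp (by positivity)
  simp only [spanNumFlow, sqrt_dist_lt_on_Icc_iff hT hε]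
  obtain ⟨S, hSK, hcard, hS⟩ := exists_sqrt_net hδ
  constructor
  · obtain ⟨R, -, hRcard, hR⟩ := Nat.sInf_mem (s := {m : ℕ | ∃ S : Finset ℝ, ↑S ⊆ Icc (0 : ℝ) 1 ∧
      S.card = m ∧ ∀ x ∈ Icc (0 : ℝ) 1, ∃ y ∈ S, |√x - √y| < ε * Real.exp (-(3 / 2 * T))})
      ⟨_, S, hSK, rfl, hS⟩
    rw [← hRcard]
    have h := one_le_card_mul_of_sqrt_net hδ hR
    rw [Real.exp_neg] at h
    field_simp at h ⊢
    linarith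
  · refine le_trans (Nat.cast_le.mpr (Nat.sInf_le ?_)) (hcard.trans ?_)
    · exact ⟨S, hSK, rfl, hS⟩
    have h : 1 / (ε * Real.exp (-(3 / 2 * T))) = 1 / ε * Real.exp (3 / 2 * T) := by
      rw [Real.exp_neg]; field_simp
    rw [h, add_mul]
    linarith

/-- A quantity within constant factors of `exp (a * T)` grows at exponential rate `a`. -/
theorem tendsto_log_div_of_exp_bounds {f : ℝ → ℝ} {a c C : ℝ} (hc : 0 < c)
    (hf : ∀ᶠ T in atTop, c * Real.exp (a * T) ≤ f T ∧ f T ≤ C * Real.exp (a * T)) :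
    Tendsto (fun T => Real.log (f T) / T) atTop (nhds a) := by
  have hlim (b : ℝ) : Tendsto (fun T : ℝ => a + Real.log b / T) atTop (nhds a) := by
    simpa using (tendsto_const_nhds (x := a)).add
      ((tendsto_const_nhds (x := Real.log b)).div_atTop tendsto_id)
  have hlog {b T : ℝ} (hb : 0 < b) (hT : 0 < T) :
      Real.log (b * Real.exp (a * T)) / T = a + Real.log b / T := by
    rw [Real.log_mul hb.ne' (Real.exp_ne_zero _), Real.log_exp]
    field_simp
    ring
  refine tendsto_of_tendsto_of_tendsto_of_le_of_le' (hlim c) (hlim C) ?_ ?_ <;>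
    filter_upwards [hf, eventually_gt_atTop 0] with T ⟨h1, h2⟩ hT
  · rw [← hlog hc hT]
    gcongr
  · have hpos : 0 < f T := lt_of_lt_of_le (by positivity) h1
    have hC : 0 < C := pos_of_mul_pos_left (hpos.trans_le h2) (Real.exp_pos _).le
    rw [← hlog hC hT]
    gcongr

/-- For the semiflow `φ_t(x) = e^{-t}·x` on `[0,∞)` with the metric
`d'(x,y) = |√x - √y|`, the compact set `K = [0,1]` and `α = 2`, the continuous-time
estimation entropy equals `3/2`. (Everything takes place inside `K = [0,1] ⊆ ℝ`.) -/
theorem estimation_entropy_linear_flow_sqrt_metric :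
    estEntropyFlow (fun x y : ℝ => |Real.sqrt x - Real.sqrt y|)
      (fun t x => Real.exp (-t) * x) (Set.Icc (0 : ℝ) 1) 2 = (3 / 2 : EReal) := by
  have h (ε : ℝ) (hε : ε ∈ Ioi (0 : ℝ)) :
      atTop.limsup (fun T : ℝ => ((Real.log (spanNumFlow (fun x y : ℝ => |√x - √y|)
        (fun t x => Real.exp (-t) * x) (Icc (0 : ℝ) 1) 2 T ε) / T : ℝ) : EReal)) =
      ((3 / 2 : ℝ) : EReal) := by
    have hε0 : 0 < ε := hε
    refine Tendsto.limsup_eq (EReal.tendsto_coe.mpr ?_)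
    refine tendsto_log_div_of_exp_bounds (c := 1 / (2 * ε)) (C := 1 / ε + 2) (by positivity) ?_
    filter_upwards [eventually_ge_atTop 0] with T hT
    exact spanNumFlow_sqrt_bounds hT hε0
  rw [estEntropyFlow, biSup_congr h, biSup_const nonempty_Ioi]
  rfl
end

section
/- Let (X,d) be a compact metric space, f : X → X a continuous map, α ≥ 0 and δ > 0. Let (Q_n)_{n≥0} be a sequence of finite partitions of X such that for every n ≥ 0, every open ball in X of radius (δ/2)·e^{−αn} intersects at most two elements of Q_n. Then for every m ∈ ℕ, the number of nonempty elements of the join ⋁_{i=0}^m f^{−i}Q_i is at most 2^{m+1} · s*_est(m, δ/2, α, X). -/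
open Filter Metric Set

/-- The join `⋁_{i=0}^n f^{-i} Q_i` of the partitions `Q 0, …, Q n` pulled back
along the iterates of `f`. -/
noncomputable def partJoin {X : Type*} (f : X → X) (Q : ℕ → Finset (Set X))
    (n : ℕ) : Finset (Set X) :=
  letI := Classical.decEq (Set X)
  ((Finset.range (n + 1)).pi fun i => Q i).image
    fun g => ⋂ i, ⋂ (h : i ∈ Finset.range (n + 1)), f^[i] ⁻¹' g i h

/-- On a compact space with continuous dynamics, the minimum defining `spanNum` is attained. -/
theorem exists_spanning_card_eq_spanNum {X : Type*} [MetricSpace X] [CompactSpace X]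
    {f : X → X} (hf : Continuous f) (α : ℝ) (n : ℕ) {ε : ℝ} (hε : 0 < ε) :
    ∃ S : Finset X, S.card = spanNum f Set.univ α n ε ∧
      ∀ x, ∃ y ∈ S, ∀ t : ℕ, t ≤ n →
        dist (f^[t] x) (f^[t] y) < ε * Real.exp (-α * t) := by
  have hne : {m : ℕ | ∃ S : Finset X, ↑S ⊆ (Set.univ : Set X) ∧ S.card = m ∧
      ∀ x ∈ (Set.univ : Set X), ∃ y ∈ S, ∀ t : ℕ, t ≤ n →
        dist (f^[t] x) (f^[t] y) < ε * Real.exp (-α * t)}.Nonempty := by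
    let U : X → Set X := fun y =>
      ⋂ t ∈ Set.Iic n, {x | dist (f^[t] x) (f^[t] y) < ε * Real.exp (-α * t)}
    have hU : ∀ y, U y ∈ nhds y := fun y =>
      ((Set.finite_Iic n).isOpen_biInter fun t _ =>
        isOpen_lt ((hf.iterate t).dist continuous_const) continuous_const).mem_nhds <| by
          simp only [Set.mem_iInter, Set.mem_ofPred_eq, dist_self]
          intro t _
          positivity
    obtain ⟨S, -, hS⟩ := isCompact_univ.elim_nhds_subcover U fun y _ => hU y
    refine ⟨S.card, S, Set.subset_univ _, rfl, fun x hx => ?_⟩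
    obtain ⟨y, hy, hxy⟩ := Set.mem_iUnion₂.1 (hS hx)
    exact ⟨y, hy, fun t ht => Set.mem_iInter₂.1 hxy t ht⟩
  obtain ⟨S, -, hcard, hS⟩ := Nat.sInf_mem hne
  exact ⟨S, hcard, fun x => hS x (Set.mem_univ x)⟩

/-- Let `X` be a compact metric space, `f` continuous, `α ≥ 0`, `δ > 0`,
and `(Q_n)` a sequence of finite partitions of `X` such that every open ball of radius
`(δ/2)·e^{-αn}` intersects at most two members of `Q_n`. Then for every `m`, the number
of nonempty members of `⋁_{i=0}^m f^{-i}Q_i` is at most `2^{m+1}·s*_est(m,δ/2,α,X)`. -/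
theorem join_card_le_spanNum {X : Type*} [MetricSpace X] [CompactSpace X]
    (f : X → X) (hf : Continuous f) (α : ℝ) (hα : 0 ≤ α) (δ : ℝ) (hδ : 0 < δ)
    (Q : ℕ → Finset (Set X))
    (hdisj : ∀ n, ∀ p ∈ Q n, ∀ q ∈ Q n, p ≠ q → Disjoint p q)
    (hcover : ∀ n, ⋃₀ (↑(Q n) : Set (Set X)) = Set.univ)
    (hball : ∀ n : ℕ, ∀ x : X,
      {q : Set X | q ∈ Q n ∧
        (Metric.ball x (δ / 2 * Real.exp (-α * n)) ∩ q).Nonempty}.ncard ≤ 2) :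
    ∀ m : ℕ,
      {p : Set X | p ∈ partJoin f Q m ∧ p.Nonempty}.ncard
        ≤ 2 ^ (m + 1) * spanNum f Set.univ α m (δ / 2) := by
  classical
  intro m
  obtain ⟨S, hcard, hS⟩ := exists_spanning_card_eq_spanNum hf α m (half_pos hδ)
  let A : X → ℕ → Finset (Set X) := fun y i =>
    {q ∈ Q i | (Metric.ball (f^[i] y) (δ / 2 * Real.exp (-α * i)) ∩ q).Nonempty}
  have hA : ∀ y i, (A y i).card ≤ 2 := fun y i => by
    simpa only [A, ← Set.ncard_coe_finset, Finset.coe_filter] using hball i (f^[i] y)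
  let J : X → Finset (Set X) := fun y =>
    ((Finset.range (m + 1)).pi (A y)).image
      fun g => ⋂ i, ⋂ (h : i ∈ Finset.range (m + 1)), f^[i] ⁻¹' g i h
  have hJ : ∀ y, (J y).card ≤ 2 ^ (m + 1) := fun y =>
    calc (J y).card ≤ ((Finset.range (m + 1)).pi (A y)).card := Finset.card_image_le
      _ = ∏ i ∈ Finset.range (m + 1), (A y i).card := Finset.card_pi _ _
      _ ≤ 2 ^ (Finset.range (m + 1)).card := Finset.prod_le_pow_card _ _ _ fun i _ => hA y i
      _ = 2 ^ (m + 1) := by rw [Finset.card_range]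
  have hsub : {p : Set X | p ∈ partJoin f Q m ∧ p.Nonempty} ⊆ ↑(S.biUnion J) := by
    rintro p ⟨hp, x, hx⟩
    obtain ⟨g, hg, rfl⟩ := Finset.mem_image.1 hp
    obtain ⟨y, hy, hxy⟩ := hS x
    refine Finset.mem_coe.2 <| Finset.mem_biUnion.2 ⟨y, hy, Finset.mem_image.2 ⟨g, ?_, rfl⟩⟩
    refine Finset.mem_pi.2 fun i hi => Finset.mem_filter.2 ⟨Finset.mem_pi.1 hg i hi, f^[i] x, ?_, ?_⟩
    · exact hxy i (Nat.lt_succ_iff.1 (Finset.mem_range.1 hi))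
    · exact Set.mem_iInter₂.1 hx i hi
  calc {p : Set X | p ∈ partJoin f Q m ∧ p.Nonempty}.ncard
      ≤ (S.biUnion J).card := by
        simpa only [Set.ncard_coe_finset] using
          Set.ncard_le_ncard hsub (Finset.finite_toSet _)
    _ ≤ S.card * 2 ^ (m + 1) := Finset.card_biUnion_le_card_mul _ _ _ fun y _ => hJ y
    _ = 2 ^ (m + 1) * spanNum f Set.univ α m (δ / 2) := by rw [hcard, mul_comm]
end

section
/- Let (Ω,ℱ,μ) be a probability space, k ≥ 2 an integer, and P = {P_1,…,P_k} a finite measurable partition of Ω. Suppose K_1,…,K_k are measurable sets with K_i ⊆ P_i and μ(P_i ∖ K_i) ≤ 1/(k·log₂ k) for every i. Let Q be the partition {K_1,…,K_k, Ω ∖ ⋃_{i=1}^k K_i}. Then the conditional entropy satisfies H_μ(P | Q) ≤ 1. -/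
open MeasureTheory

/-- The partition `Q = {K_1, …, K_k, Ω ∖ ⋃ K_i}`, indexed by `Option (Fin k)`:
`some i ↦ K i` and `none ↦ (⋃ i, K i)ᶜ`. -/
def refinedPart {Ω : Type*} {k : ℕ} (K : Fin k → Set Ω) : Option (Fin k) → Set Ω :=
  fun j => Option.elim j (⋃ i, K i)ᶜ K

/-- The conditional entropy `H_μ(P|Q)` (base 2), written as
`-∑_{Q'} μ(Q') ∑_{P'} μ(P'|Q')·log₂ μ(P'|Q')` with the conventions `0·log₂ 0 = 0`
and `0/0 = 0` (so cells `Q'` with `μ(Q') = 0` contribute nothing). -/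
noncomputable def condEnt2 {Ω : Type*} [MeasurableSpace Ω] (μ : Measure Ω) {k : ℕ}
    (P : Fin k → Set Ω) (Q : Option (Fin k) → Set Ω) : ℝ :=
  -∑ j : Option (Fin k), (μ (Q j)).toReal *
      ∑ i : Fin k, ((μ (P i ∩ Q j)).toReal / (μ (Q j)).toReal) *
        Real.logb 2 ((μ (P i ∩ Q j)).toReal / (μ (Q j)).toReal)

theorem neg_mul_log_le_tangent {p c : ℝ} (hp : 0 ≤ p) (hc : 0 < c) :
    -(p * Real.log p) ≤ p * Real.log c + 1 / c - p := by
  rcases hp.eq_or_lt with rfl | hp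
  · simp [hc.le]
  · have h := mul_le_mul_of_nonneg_left
      (Real.log_le_sub_one_of_pos (x := 1 / (c * p)) (by positivity)) hp.le
    rw [one_div, Real.log_inv, Real.log_mul hc.ne' hp.ne'] at h
    have h' : p * ((c * p)⁻¹ - 1) = 1 / c - p := by field_simp
    rw [h'] at h
    linarith

/-- The base 2 entropy of a probability vector of length `k` is at most `log₂ k`. -/
theorem neg_sum_mul_logb_le_logb_card {k : ℕ} (hk : 0 < k) (p : Fin k → ℝ)
    (hp : ∀ i, 0 ≤ p i) (hsum : ∑ i, p i = 1) :
    -∑ i, p i * Real.logb 2 (p i) ≤ Real.logb 2 k := by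
  have hk' : (0 : ℝ) < k := by exact_mod_cast hk
  have h : ∑ i, -(p i * Real.log (p i)) ≤ ∑ i, (p i * Real.log k + 1 / k - p i) :=
    Finset.sum_le_sum fun i _ => neg_mul_log_le_tangent (hp i) hk'
  have hk1 : (k : ℝ) * (1 / k) = 1 := by field_simp
  rw [Finset.sum_neg_distrib, Finset.sum_sub_distrib, Finset.sum_add_distrib, ← Finset.sum_mul,
    hsum, Finset.sum_const, Finset.card_univ, Fintype.card_fin, nsmul_eq_mul, hk1] at h
  simp only [Real.logb, ← mul_div_assoc]
  rw [← Finset.sum_div, ← neg_div]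
  exact div_le_div_of_nonneg_right (by linarith) (Real.log_pos one_lt_two).le

/-- Conditional on a cell contained in a single atom, the entropy vanishes. -/
theorem sum_condProb_mul_logb_eq_zero {Ω : Type*} [MeasurableSpace Ω] (μ : Measure Ω) {k : ℕ}
    (P : Fin k → Set Ω) (hPdisj : ∀ i j, i ≠ j → Disjoint (P i) (P j)) {j : Fin k} {A : Set Ω}
    (hA : A ⊆ P j) :
    ∑ i : Fin k, ((μ (P i ∩ A)).toReal / (μ A).toReal) *
      Real.logb 2 ((μ (P i ∩ A)).toReal / (μ A).toReal) = 0 := by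
  refine Finset.sum_eq_zero fun i _ => ?_
  by_cases hij : i = j
  · subst hij
    rw [Set.inter_eq_self_of_subset_right hA]
    by_cases h0 : (μ A).toReal = 0
    · simp [h0]
    · simp [div_self h0]
  · have : P i ∩ A = ∅ := ((hPdisj i j hij).mono_right hA).inter_eq
    simp [this]

theorem sum_toReal_measure_inter {Ω : Type*} [MeasurableSpace Ω] (μ : Measure Ω)
    [IsFiniteMeasure μ] {k : ℕ} (P : Fin k → Set Ω) (hPmeas : ∀ i, MeasurableSet (P i))
    (hPdisj : ∀ i j, i ≠ j → Disjoint (P i) (P j)) (hPcover : (⋃ i, P i) = Set.univ)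
    {A : Set Ω} (hA : MeasurableSet A) :
    ∑ i, (μ (P i ∩ A)).toReal = (μ A).toReal := by
  rw [← ENNReal.toReal_sum fun i _ => measure_ne_top μ _, ← tsum_fintype (L := .unconditional _),
    ← measure_iUnion
      (fun i j hij => (hPdisj i j hij).mono Set.inter_subset_left Set.inter_subset_left)
      (fun i => (hPmeas i).inter hA),
    ← Set.iUnion_inter, hPcover, Set.univ_inter]

/-- Let `(Ω,ℱ,μ)` be a probability space, `k ≥ 2`, `P = {P_1,…,P_k}` a
finite measurable partition, and `K_i ⊆ P_i` measurable sets with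
`μ(P_i ∖ K_i) ≤ 1/(k·log₂ k)` for every `i`. If `Q = {K_1,…,K_k, Ω ∖ ⋃ K_i}`, then
`H_μ(P|Q) ≤ 1`. -/
theorem condEnt_le_one {Ω : Type*} [MeasurableSpace Ω] (μ : Measure Ω)
    [IsProbabilityMeasure μ] (k : ℕ) (hk : 2 ≤ k)
    (P : Fin k → Set Ω)
    (hPmeas : ∀ i, MeasurableSet (P i))
    (hPdisj : ∀ i j, i ≠ j → Disjoint (P i) (P j))
    (hPcover : (⋃ i, P i) = Set.univ)
    (K : Fin k → Set Ω)
    (hKmeas : ∀ i, MeasurableSet (K i))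
    (hKP : ∀ i, K i ⊆ P i)
    (hKsmall : ∀ i, μ (P i \ K i) ≤ ENNReal.ofReal (1 / (k * Real.logb 2 k))) :
    condEnt2 μ P (refinedPart K) ≤ 1 := by
  have hk0 : (0 : ℝ) < k := by positivity
  have hL : 0 < Real.logb 2 k := Real.logb_pos one_lt_two (by exact_mod_cast hk)
  set C : Set Ω := (⋃ i, K i)ᶜ with hC
  have hCmeas : MeasurableSet C := (MeasurableSet.iUnion hKmeas).compl
  have hsum := sum_toReal_measure_inter μ P hPmeas hPdisj hPcover hCmeas
  have hm : (μ C).toReal ≤ 1 / Real.logb 2 k := by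
    have hcell : ∀ i ∈ Finset.univ, (μ (P i ∩ C)).toReal ≤ 1 / (k * Real.logb 2 k) := by
      intro i _
      refine ENNReal.toReal_le_of_le_ofReal (by positivity) ((measure_mono ?_).trans (hKsmall i))
      exact fun x hx => ⟨hx.1, fun hxK => hx.2 (Set.mem_iUnion_of_mem i hxK)⟩
    have h := Finset.sum_le_sum hcell
    rw [hsum, Finset.sum_const, Finset.card_univ, Fintype.card_fin, nsmul_eq_mul] at h
    refine h.trans_eq ?_
    field_simp
  have hnone : condEnt2 μ P (refinedPart K) = (μ C).toReal *
      -∑ i : Fin k, ((μ (P i ∩ C)).toReal / (μ C).toReal) *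
        Real.logb 2 ((μ (P i ∩ C)).toReal / (μ C).toReal) := by
    simp only [condEnt2, refinedPart, Fintype.sum_option, Option.elim_none, Option.elim_some,
      sum_condProb_mul_logb_eq_zero μ P hPdisj (hKP _), mul_zero, Finset.sum_const_zero, add_zero,
      mul_neg, ← hC]
  rw [hnone]
  by_cases h0 : (μ C).toReal = 0
  · simp [h0]
  · have hent := neg_sum_mul_logb_le_logb_card (by lia)
      (fun i => (μ (P i ∩ C)).toReal / (μ C).toReal) (fun i => by positivity)
      (by rw [← Finset.sum_div, hsum, div_self h0])
    calc _ ≤ (μ C).toReal * Real.logb 2 k := mul_le_mul_of_nonneg_left hent ENNReal.toReal_nonneg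
      _ ≤ 1 / Real.logb 2 k * Real.logb 2 k := mul_le_mul_of_nonneg_right hm hL.le
      _ = 1 := by field_simp
end

section
/- Let 𝕋² = ℝ²/ℤ² be the 2-torus with the flat metric d(x+ℤ², y+ℤ²) = min_{n∈ℤ²} ‖x − y + n‖ (Euclidean norm), and let f_A : 𝕋² → 𝕋² be the automorphism induced by the matrix A = [[2,1],[1,1]]. Let γ = (3+√5)/2. Then for every α ≥ 0, the estimation entropy (computed with the natural logarithm) satisfies h_est(α, 𝕋²; f_A) = α + ln γ if 0 ≤ α ≤ ln γ, and h_est(α, 𝕋²; f_A) = 2α if α ≥ ln γ. -/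
open Filter Metric Set

/-- Minimal cardinality of an `(n,ε,α,K)`-spanning set for a map `g`, with respect
to a distance function `d`. -/
noncomputable def spanNumD {X : Type*} (d : X → X → ℝ) (g : X → X) (K : Set X)
    (α : ℝ) (n : ℕ) (ε : ℝ) : ℕ :=
  sInf {m : ℕ | ∃ S : Finset X, ↑S ⊆ K ∧ S.card = m ∧
    ∀ x ∈ K, ∃ y ∈ S, ∀ t : ℕ, t ≤ n →
      d (g^[t] x) (g^[t] y) < ε * Real.exp (-α * t)}

/-- Estimation entropy with respect to the distance function `d` (natural logarithm);
the limit as `ε ↓ 0` is realized as the supremum over `ε > 0`, by monotonicity. -/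
noncomputable def estEntropyD {X : Type*} (d : X → X → ℝ) (g : X → X) (K : Set X)
    (α : ℝ) : EReal :=
  ⨆ ε ∈ Set.Ioi (0 : ℝ),
    atTop.limsup fun n : ℕ => ((Real.log (spanNumD d g K α n ε) / n : ℝ) : EReal)

/-- The linear map on `ℝ²` given by the matrix `[[2,1],[1,1]]`. -/
noncomputable def catMap : EuclideanSpace ℝ (Fin 2) → EuclideanSpace ℝ (Fin 2) :=
  fun x => (WithLp.equiv 2 (Fin 2 → ℝ)).symm ![2 * x 0 + x 1, x 0 + x 1]

/-- The integer lattice `ℤ² ⊆ ℝ²`. -/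
noncomputable def intLattice : AddSubgroup (EuclideanSpace ℝ (Fin 2)) where
  carrier := {v | ∀ i, ∃ n : ℤ, v i = n}
  zero_mem' := fun i => ⟨0, by simp⟩
  add_mem' := by
    intro a b ha hb i
    obtain ⟨m, hm⟩ := ha i
    obtain ⟨n, hn⟩ := hb i
    exact ⟨m + n, by push_cast [← hm, ← hn]; rfl⟩
  neg_mem' := by
    intro a ha i
    obtain ⟨m, hm⟩ := ha i
    exact ⟨-m, by push_cast [← hm]; rfl⟩

/-- The 2-torus `𝕋² = ℝ²/ℤ²`. -/
abbrev Torus2 := EuclideanSpace ℝ (Fin 2) ⧸ intLattice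

/-- The expansion rate `log γ` of the cat map along its unstable direction. -/
noncomputable def catRate : ℝ := Real.log ((3 + Real.sqrt 5) / 2)

/-- The unstable coordinate, a left eigenvector of the cat map for the eigenvalue `φ ^ 2`. -/
noncomputable def unstableCoord (v : EuclideanSpace ℝ (Fin 2)) : ℝ :=
  Real.goldenRatio * v 0 + v 1

/-- The stable coordinate, a left eigenvector of the cat map for the eigenvalue `ψ ^ 2`. -/
noncomputable def stableCoord (v : EuclideanSpace ℝ (Fin 2)) : ℝ :=
  Real.goldenConj * v 0 + v 1

/-- The point with prescribed unstable and stable coordinates. -/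
noncomputable def ofCoords (a b : ℝ) : EuclideanSpace ℝ (Fin 2) :=
  !₂[(a - b) / Real.sqrt 5, (Real.goldenRatio * b - Real.goldenConj * a) / Real.sqrt 5]

theorem goldenRatio_sub_goldenConj_eq_sqrt :
    Real.goldenRatio - Real.goldenConj = Real.sqrt 5 := by
  simp only [Real.goldenRatio, Real.goldenConj]; ring

theorem sqrt_five_pos : 0 < Real.sqrt 5 := by positivity

theorem two_lt_sqrt_five : 2 < Real.sqrt 5 := by
  rw [Real.lt_sqrt] <;> norm_num

theorem unstableCoord_ofCoords (a b : ℝ) : unstableCoord (ofCoords a b) = a := by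
  have h5 := sqrt_five_pos
  simp only [unstableCoord, ofCoords, PiLp.toLp_apply, Matrix.cons_val_zero, Matrix.cons_val_one]
  field_simp
  rw [← goldenRatio_sub_goldenConj_eq_sqrt]
  ring

theorem stableCoord_ofCoords (a b : ℝ) : stableCoord (ofCoords a b) = b := by
  have h5 := sqrt_five_pos
  simp only [stableCoord, ofCoords, PiLp.toLp_apply, Matrix.cons_val_zero, Matrix.cons_val_one]
  field_simp
  rw [← goldenRatio_sub_goldenConj_eq_sqrt]
  ring

theorem unstableCoord_sub (v w : EuclideanSpace ℝ (Fin 2)) :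
    unstableCoord (v - w) = unstableCoord v - unstableCoord w := by
  simp only [unstableCoord, PiLp.sub_apply]; ring

theorem stableCoord_sub (v w : EuclideanSpace ℝ (Fin 2)) :
    stableCoord (v - w) = stableCoord v - stableCoord w := by
  simp only [stableCoord, PiLp.sub_apply]; ring

theorem abs_apply_le_norm (v : EuclideanSpace ℝ (Fin 2)) (i : Fin 2) : |v i| ≤ ‖v‖ := by
  simpa using PiLp.norm_apply_le v i

theorem norm_le_abs_add_abs (v : EuclideanSpace ℝ (Fin 2)) : ‖v‖ ≤ |v 0| + |v 1| := by
  rw [EuclideanSpace.norm_eq, Fin.sum_univ_two, Real.sqrt_le_iff]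
  refine ⟨by positivity, ?_⟩
  simp only [Real.norm_eq_abs]
  nlinarith [abs_nonneg (v 0), abs_nonneg (v 1)]

theorem abs_unstableCoord_le (v : EuclideanSpace ℝ (Fin 2)) :
    |unstableCoord v| ≤ 2 * |v 0| + |v 1| := by
  refine (abs_add_le _ _).trans ?_
  rw [abs_mul, abs_of_pos Real.goldenRatio_pos]
  gcongr
  exact Real.goldenRatio_lt_two.le

theorem abs_stableCoord_le (v : EuclideanSpace ℝ (Fin 2)) :
    |stableCoord v| ≤ |v 0| + |v 1| := by
  refine (abs_add_le _ _).trans ?_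
  rw [abs_mul, abs_of_neg Real.goldenConj_neg]
  have := Real.neg_one_lt_goldenConj
  nlinarith [abs_nonneg (v 0)]

theorem norm_le_coords (v : EuclideanSpace ℝ (Fin 2)) :
    ‖v‖ ≤ 2 * (|unstableCoord v| + |stableCoord v|) := by
  have h5 := two_lt_sqrt_five
  have hd : unstableCoord v - stableCoord v = Real.sqrt 5 * v 0 := by
    rw [← goldenRatio_sub_goldenConj_eq_sqrt]; simp only [unstableCoord, stableCoord]; ring
  have h0 : 2 * |v 0| ≤ |unstableCoord v| + |stableCoord v| := by
    have h := abs_sub (unstableCoord v) (stableCoord v)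
    rw [hd, abs_mul, abs_of_pos (by linarith : (0 : ℝ) < Real.sqrt 5)] at h
    nlinarith [abs_nonneg (v 0)]
  have h1 : |v 1| ≤ |stableCoord v| + |v 0| := by
    have e : v 1 = stableCoord v - Real.goldenConj * v 0 := by simp only [stableCoord]; ring
    have h := abs_sub (stableCoord v) (Real.goldenConj * v 0)
    rw [← e, abs_mul, abs_of_neg Real.goldenConj_neg] at h
    have := Real.neg_one_lt_goldenConj
    nlinarith [abs_nonneg (v 0)]
  have := norm_le_abs_add_abs v
  have := abs_nonneg (unstableCoord v)
  have := abs_nonneg (stableCoord v)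
  linarith

theorem exp_catRate : Real.exp catRate = Real.goldenRatio ^ 2 := by
  rw [catRate, Real.exp_log (by positivity), Real.goldenRatio_sq, Real.goldenRatio]
  ring

theorem exp_neg_catRate : Real.exp (-catRate) = Real.goldenConj ^ 2 := by
  rw [Real.exp_neg, exp_catRate, ← inv_pow, Real.inv_goldenRatio, neg_sq]

theorem catRate_pos : 0 < catRate := by
  apply Real.log_pos
  linarith [two_lt_sqrt_five]

theorem catMap_apply_zero (v : EuclideanSpace ℝ (Fin 2)) : catMap v 0 = 2 * v 0 + v 1 := by
  simp [catMap]

theorem catMap_apply_one (v : EuclideanSpace ℝ (Fin 2)) : catMap v 1 = v 0 + v 1 := by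
  simp [catMap]

theorem unstableCoord_catMap (v : EuclideanSpace ℝ (Fin 2)) :
    unstableCoord (catMap v) = Real.exp catRate * unstableCoord v := by
  rw [exp_catRate]
  simp only [unstableCoord, catMap_apply_zero, catMap_apply_one]
  linear_combination (-(Real.goldenRatio + 1) * v 0 - v 1) * Real.goldenRatio_sq

theorem stableCoord_catMap (v : EuclideanSpace ℝ (Fin 2)) :
    stableCoord (catMap v) = Real.exp (-catRate) * stableCoord v := by
  rw [exp_neg_catRate]
  simp only [stableCoord, catMap_apply_zero, catMap_apply_one]
  linear_combination (-(Real.goldenConj + 1) * v 0 - v 1) * Real.goldenConj_sq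

theorem unstableCoord_iterate_catMap (t : ℕ) (v : EuclideanSpace ℝ (Fin 2)) :
    unstableCoord (catMap^[t] v) = Real.exp (catRate * t) * unstableCoord v := by
  induction t with
  | zero => simp
  | succ t ih =>
    rw [Function.iterate_succ_apply', unstableCoord_catMap, ih, ← mul_assoc, ← Real.exp_add]
    congr 2; push_cast; ring

theorem stableCoord_iterate_catMap (t : ℕ) (v : EuclideanSpace ℝ (Fin 2)) :
    stableCoord (catMap^[t] v) = Real.exp (-catRate * t) * stableCoord v := by
  induction t with
  | zero => simp
  | succ t ih =>
    rw [Function.iterate_succ_apply', stableCoord_catMap, ih, ← mul_assoc, ← Real.exp_add]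
    congr 2; push_cast; ring

theorem catMap_sub (v w : EuclideanSpace ℝ (Fin 2)) : catMap (v - w) = catMap v - catMap w := by
  ext i
  fin_cases i <;>
    simp only [Fin.zero_eta, Fin.mk_one, PiLp.sub_apply, catMap_apply_zero, catMap_apply_one] <;>
    ring

theorem iterate_catMap_sub (t : ℕ) (v w : EuclideanSpace ℝ (Fin 2)) :
    catMap^[t] (v - w) = catMap^[t] v - catMap^[t] w := by
  induction t with
  | zero => rfl
  | succ t ih => simp only [Function.iterate_succ_apply', ih, catMap_sub]

theorem norm_catMap_le (v : EuclideanSpace ℝ (Fin 2)) : ‖catMap v‖ ≤ 5 * ‖v‖ := by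
  have h := norm_le_abs_add_abs (catMap v)
  rw [catMap_apply_zero, catMap_apply_one] at h
  have h1 := abs_add_le (2 * v 0) (v 1)
  rw [abs_mul, abs_two] at h1
  have h2 := abs_add_le (v 0) (v 1)
  linarith [abs_apply_le_norm v 0, abs_apply_le_norm v 1]

theorem one_le_norm_of_mem_intLattice {m : EuclideanSpace ℝ (Fin 2)} (hm : m ∈ intLattice)
    (h0 : m ≠ 0) : 1 ≤ ‖m‖ := by
  obtain ⟨i, hi⟩ : ∃ i, m i ≠ 0 := by
    by_contra! h
    exact h0 (PiLp.ext h)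
  obtain ⟨k, hk⟩ := hm i
  have hk0 : k ≠ 0 := by
    rintro rfl
    exact hi (hk.trans Int.cast_zero)
  have h1 : (1 : ℝ) ≤ |(k : ℝ)| := by exact_mod_cast Int.one_le_abs hk0
  exact h1.trans (hk ▸ abs_apply_le_norm m i)

/-- A vector of norm less than `1 / 2` is its own shortest representative modulo the lattice. -/
theorem norm_lt_of_norm_add_lt {v m : EuclideanSpace ℝ (Fin 2)} {r : ℝ} (hm : m ∈ intLattice)
    (hv : ‖v‖ < 1 / 2) (hr : r ≤ 1 / 2) (h : ‖v + m‖ < r) : ‖v‖ < r := by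
  rcases eq_or_ne m 0 with rfl | h0
  · simpa using h
  · have h1 := one_le_norm_of_mem_intLattice hm h0
    have h2 := norm_sub_le (v + m) v
    rw [add_sub_cancel_left] at h2
    linarith

/-- If the orbit of a short vector stays close to the lattice, then it stays close to `0`. -/
theorem norm_iterate_catMap_lt {v : EuclideanSpace ℝ (Fin 2)} {n : ℕ} {r : ℕ → ℝ}
    (hv : ‖v‖ < 1 / 2) (hr : ∀ t, r t ≤ 1 / 10)
    (h : ∀ t ≤ n, ∃ m ∈ intLattice, ‖catMap^[t] v + m‖ < r t) :
    ∀ t ≤ n, ‖catMap^[t] v‖ < r t := by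
  intro t
  induction t with
  | zero =>
    intro ht
    obtain ⟨m, hm, hlt⟩ := h 0 ht
    exact norm_lt_of_norm_add_lt hm hv (by linarith [hr 0]) hlt
  | succ t ih =>
    intro ht
    obtain ⟨m, hm, hlt⟩ := h (t + 1) ht
    refine norm_lt_of_norm_add_lt hm ?_ (by linarith [hr (t + 1)]) hlt
    rw [Function.iterate_succ_apply']
    linarith [norm_catMap_le (catMap^[t] v), ih (by omega), hr t]

/-- Every point of the torus has a representative with coordinates bounded by `3`. -/
theorem exists_rep_bounded (x : Torus2) : ∃ v : EuclideanSpace ℝ (Fin 2),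
    (v : Torus2) = x ∧ |unstableCoord v| ≤ 3 ∧ |stableCoord v| ≤ 3 := by
  obtain ⟨w, rfl⟩ := QuotientAddGroup.mk_surjective x
  have habs : ∀ i, |(!₂[Int.fract (w 0), Int.fract (w 1)] : EuclideanSpace ℝ (Fin 2)) i| ≤ 1 := by
    intro i
    have hf : ∀ a : ℝ, |Int.fract a| ≤ 1 := fun a => by
      rw [abs_of_nonneg (Int.fract_nonneg a)]; exact (Int.fract_lt_one a).le
    fin_cases i <;> simpa using hf _
  refine ⟨!₂[Int.fract (w 0), Int.fract (w 1)], ?_, ?_, ?_⟩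
  · rw [QuotientAddGroup.eq]
    intro i
    fin_cases i
    · exact ⟨⌊w 0⌋, by simp [← sub_eq_neg_add]⟩
    · exact ⟨⌊w 1⌋, by simp [← sub_eq_neg_add]⟩
  · exact (abs_unstableCoord_le _).trans (by linarith [habs 0, habs 1])
  · exact (abs_stableCoord_le _).trans (by linarith [habs 0, habs 1])

/-- Points of a mesh of size `δ` approximate `[-3, 3]`. -/
theorem exists_mesh_point {δ a : ℝ} (hδ : 0 < δ) (ha : |a| ≤ 3) :
    ∃ i ∈ Finset.Icc (-(⌈3 / δ⌉₊ : ℤ)) ⌈3 / δ⌉₊, |a - i * δ| ≤ δ := by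
  have hN : 3 ≤ (⌈3 / δ⌉₊ : ℝ) * δ := by
    rw [← div_le_iff₀ hδ]; exact Nat.le_ceil _
  obtain ⟨ha1, ha2⟩ := abs_le.mp ha
  refine ⟨⌊a / δ⌋, Finset.mem_Icc.mpr ⟨?_, ?_⟩, ?_⟩
  · rw [Int.le_floor, le_div_iff₀ hδ]
    push_cast
    linarith
  · have : (⌊a / δ⌋ : ℝ) ≤ (⌈3 / δ⌉₊ : ℝ) :=
      (Int.floor_le _).trans ((div_le_iff₀ hδ).mpr (by linarith))
    exact_mod_cast this
  · have h1 := (le_div_iff₀ hδ).mp (Int.floor_le (a / δ))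
    have h2 := (div_lt_iff₀ hδ).mp (Int.lt_floor_add_one (a / δ))
    rw [abs_le]
    constructor <;> linarith

theorem card_mesh_le {c x : ℝ} (hc : 0 < c) (hx : 0 ≤ x) :
    ((Finset.Icc (-(⌈3 / (c * Real.exp (-x))⌉₊ : ℤ)) ⌈3 / (c * Real.exp (-x))⌉₊).card : ℝ)
      ≤ (6 / c + 3) * Real.exp x := by
  set N := ⌈3 / (c * Real.exp (-x))⌉₊
  have hcard : (Finset.Icc (-(N : ℤ)) N).card = 2 * N + 1 := by
    rw [Int.card_Icc]; omega
  have hN : (N : ℝ) < 3 / (c * Real.exp (-x)) + 1 := Nat.ceil_lt_add_one (by positivity)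
  have he : 3 / (c * Real.exp (-x)) = 3 / c * Real.exp x := by
    rw [Real.exp_neg]; field_simp
  rw [he] at hN
  rw [hcard]
  push_cast
  have h1 := Real.one_le_exp hx
  calc 2 * (N : ℝ) + 1 ≤ 2 * (3 / c * Real.exp x) + 3 * 1 := by linarith
    _ ≤ 2 * (3 / c * Real.exp x) + 3 * Real.exp x := by linarith
    _ = _ := by ring

section Torus

variable {dT : Torus2 → Torus2 → ℝ} {fA : Torus2 → Torus2}

theorem torusDist_lt_iff
    (hdT : ∀ v w : EuclideanSpace ℝ (Fin 2),
      dT ↑v ↑w = ⨅ n : intLattice, ‖v - w + (n : EuclideanSpace ℝ (Fin 2))‖)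
    (v w : EuclideanSpace ℝ (Fin 2)) (r : ℝ) :
    dT ↑v ↑w < r ↔ ∃ m ∈ intLattice, ‖v - w + m‖ < r := by
  rw [hdT, ciInf_lt_iff ⟨0, by rintro _ ⟨n, rfl⟩; positivity⟩]
  simp

theorem iterate_torus_mk (hfA : ∀ v : EuclideanSpace ℝ (Fin 2), fA ↑v = ↑(catMap v))
    (t : ℕ) (v : EuclideanSpace ℝ (Fin 2)) :
    fA^[t] (v : Torus2) = ((catMap^[t] v : EuclideanSpace ℝ (Fin 2)) : Torus2) := by
  induction t with
  | zero => rfl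
  | succ t ih => rw [Function.iterate_succ_apply', Function.iterate_succ_apply', ih, hfA]

/-- Points whose coordinates are close enough stay close for times up to `n`. -/
theorem norm_iterate_catMap_lt_of_coords {α β ε : ℝ} (hα : 0 ≤ α) (hβ : 0 ≤ β)
    (hαβ : α - catRate ≤ β) (hε : 0 < ε) {n t : ℕ} (ht : t ≤ n)
    {v : EuclideanSpace ℝ (Fin 2)}
    (hu : |unstableCoord v| ≤ ε / 8 * Real.exp (-((α + catRate) * n)))
    (hs : |stableCoord v| ≤ ε / 8 * Real.exp (-(β * n))) :
    ‖catMap^[t] v‖ < ε * Real.exp (-α * t) := by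
  have htn : (t : ℝ) ≤ n := by exact_mod_cast ht
  have hL := catRate_pos
  have hE := Real.exp_pos (-α * t)
  have hu' : |unstableCoord (catMap^[t] v)| ≤ ε / 8 * Real.exp (-α * t) := by
    rw [unstableCoord_iterate_catMap, abs_mul, Real.abs_exp]
    calc Real.exp (catRate * t) * |unstableCoord v|
        ≤ Real.exp (catRate * t) * (ε / 8 * Real.exp (-((α + catRate) * n))) := by gcongr
      _ = ε / 8 * Real.exp (catRate * t + -((α + catRate) * n)) := by rw [Real.exp_add]; ring
      _ ≤ ε / 8 * Real.exp (-α * t) := by gcongr; nlinarith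
  have hs' : |stableCoord (catMap^[t] v)| ≤ ε / 8 * Real.exp (-α * t) := by
    rw [stableCoord_iterate_catMap, abs_mul, Real.abs_exp]
    calc Real.exp (-catRate * t) * |stableCoord v|
        ≤ Real.exp (-catRate * t) * (ε / 8 * Real.exp (-(β * n))) := by gcongr
      _ = ε / 8 * Real.exp (-catRate * t + -(β * n)) := by rw [Real.exp_add]; ring
      _ ≤ ε / 8 * Real.exp (-α * t) := by gcongr; nlinarith [(Nat.cast_nonneg t : (0 : ℝ) ≤ t)]
  have := norm_le_coords (catMap^[t] v)
  nlinarith [mul_pos hε hE]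

/-- The mesh in eigencoordinates is a spanning set. -/
theorem exists_spanning_finset
    (hdT : ∀ v w : EuclideanSpace ℝ (Fin 2),
      dT ↑v ↑w = ⨅ n : intLattice, ‖v - w + (n : EuclideanSpace ℝ (Fin 2))‖)
    (hfA : ∀ v : EuclideanSpace ℝ (Fin 2), fA ↑v = ↑(catMap v))
    {α β ε : ℝ} (hα : 0 ≤ α) (hβ : 0 ≤ β) (hαβ : α - catRate ≤ β) (hε : 0 < ε) (n : ℕ) :
    ∃ S : Finset Torus2,
      (S.card : ℝ) ≤ (6 / (ε / 8) + 3) ^ 2 * Real.exp ((α + catRate + β) * n) ∧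
      ∀ x, ∃ y ∈ S, ∀ t : ℕ, t ≤ n →
        dT (fA^[t] x) (fA^[t] y) < ε * Real.exp (-α * t) := by
  classical
  have hL := catRate_pos
  set δu := ε / 8 * Real.exp (-((α + catRate) * n)) with hδu
  set δs := ε / 8 * Real.exp (-(β * n)) with hδs
  have hδu0 : 0 < δu := by positivity
  have hδs0 : 0 < δs := by positivity
  let I := Finset.Icc (-(⌈3 / δu⌉₊ : ℤ)) ⌈3 / δu⌉₊
  let J := Finset.Icc (-(⌈3 / δs⌉₊ : ℤ)) ⌈3 / δs⌉₊
  refine ⟨(I ×ˢ J).image fun p => (ofCoords (p.1 * δu) (p.2 * δs) : Torus2), ?_, ?_⟩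
  · have hI : (I.card : ℝ) ≤ (6 / (ε / 8) + 3) * Real.exp ((α + catRate) * n) :=
      card_mesh_le (by positivity) (by positivity)
    have hJ : (J.card : ℝ) ≤ (6 / (ε / 8) + 3) * Real.exp (β * n) :=
      card_mesh_le (by positivity) (by positivity)
    calc _ ≤ (((I ×ˢ J).card : ℕ) : ℝ) := by exact_mod_cast Finset.card_image_le
      _ = I.card * J.card := by rw [Finset.card_product]; push_cast; rfl
      _ ≤ ((6 / (ε / 8) + 3) * Real.exp ((α + catRate) * n)) *
          ((6 / (ε / 8) + 3) * Real.exp (β * n)) := by gcongr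
      _ = _ := by rw [add_mul _ β, Real.exp_add]; ring
  · intro x
    obtain ⟨v, rfl, hu, hs⟩ := exists_rep_bounded x
    obtain ⟨i, hi, hui⟩ := exists_mesh_point hδu0 hu
    obtain ⟨j, hj, hsj⟩ := exists_mesh_point hδs0 hs
    refine ⟨_, Finset.mem_image_of_mem _ (Finset.mk_mem_product hi hj), fun t ht => ?_⟩
    rw [iterate_torus_mk hfA, iterate_torus_mk hfA, torusDist_lt_iff hdT]
    refine ⟨0, zero_mem _, ?_⟩
    rw [add_zero, ← iterate_catMap_sub]
    apply norm_iterate_catMap_lt_of_coords hα hβ hαβ hε ht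
    · rwa [unstableCoord_sub, unstableCoord_ofCoords]
    · rwa [stableCoord_sub, stableCoord_ofCoords]

/-- Nearby points shadowed by a common orbit have close coordinates. -/
theorem coords_lt_of_shadowed
    (hdT : ∀ v w : EuclideanSpace ℝ (Fin 2),
      dT ↑v ↑w = ⨅ n : intLattice, ‖v - w + (n : EuclideanSpace ℝ (Fin 2))‖)
    (hfA : ∀ v : EuclideanSpace ℝ (Fin 2), fA ↑v = ↑(catMap v))
    {α : ℝ} (hα : 0 ≤ α) {n : ℕ} {v w : EuclideanSpace ℝ (Fin 2)} {y : Torus2}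
    (hvw : ‖v - w‖ < 1 / 2)
    (hv : ∀ t : ℕ, t ≤ n → dT (fA^[t] v) (fA^[t] y) < 1 / 32 * Real.exp (-α * t))
    (hw : ∀ t : ℕ, t ≤ n → dT (fA^[t] w) (fA^[t] y) < 1 / 32 * Real.exp (-α * t)) :
    |unstableCoord v - unstableCoord w| < Real.exp (-((α + catRate) * n)) ∧
    |stableCoord v - stableCoord w| < Real.exp (-(max 0 (α - catRate) * n)) := by
  obtain ⟨y, rfl⟩ := QuotientAddGroup.mk_surjective y
  have key : ∀ t ≤ n, ‖catMap^[t] (v - w)‖ < 1 / 16 * Real.exp (-α * t) := by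
    refine norm_iterate_catMap_lt (r := fun t => 1 / 16 * Real.exp (-α * t)) hvw ?_ ?_
    · intro t
      have : Real.exp (-α * t) ≤ 1 := by
        rw [Real.exp_le_one_iff, neg_mul]
        exact neg_nonpos.mpr (by positivity)
      linarith
    · intro t ht
      have h1 := hv t ht
      have h2 := hw t ht
      rw [iterate_torus_mk hfA, iterate_torus_mk hfA, torusDist_lt_iff hdT] at h1 h2
      obtain ⟨m1, hm1, h1⟩ := h1
      obtain ⟨m2, hm2, h2⟩ := h2
      refine ⟨m1 - m2, sub_mem hm1 hm2, ?_⟩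
      have e : catMap^[t] (v - w) + (m1 - m2) =
          (catMap^[t] v - catMap^[t] y + m1) - (catMap^[t] w - catMap^[t] y + m2) := by
        rw [iterate_catMap_sub]; abel
      rw [e]
      linarith [norm_sub_le (catMap^[t] v - catMap^[t] y + m1) (catMap^[t] w - catMap^[t] y + m2)]
  have hun : ∀ z : EuclideanSpace ℝ (Fin 2), |unstableCoord z| ≤ 3 * ‖z‖ := fun z => by
    linarith [abs_unstableCoord_le z, abs_apply_le_norm z 0, abs_apply_le_norm z 1]
  have hst : ∀ z : EuclideanSpace ℝ (Fin 2), |stableCoord z| ≤ 2 * ‖z‖ := fun z => by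
    linarith [abs_stableCoord_le z, abs_apply_le_norm z 0, abs_apply_le_norm z 1]
  have hs : ∀ t ≤ n, |stableCoord (v - w)| < Real.exp (-((α - catRate) * t)) := by
    intro t ht
    have h := (hst _).trans_lt (mul_lt_mul_of_pos_left (key t ht) two_pos)
    rw [stableCoord_iterate_catMap, abs_mul, Real.abs_exp] at h
    have h' : Real.exp (-catRate * t) * |stableCoord (v - w)| < Real.exp (-α * t) := by
      linarith [Real.exp_pos (-α * t)]
    have e : Real.exp (-α * t) = Real.exp (-catRate * t) * Real.exp (-((α - catRate) * t)) := by
      rw [← Real.exp_add]; congr 1; ring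
    rw [e] at h'
    exact lt_of_mul_lt_mul_left h' (Real.exp_pos _).le
  rw [← unstableCoord_sub, ← stableCoord_sub]
  constructor
  · have h := (hun _).trans_lt (mul_lt_mul_of_pos_left (key n le_rfl) three_pos)
    rw [unstableCoord_iterate_catMap, abs_mul, Real.abs_exp] at h
    have h' : Real.exp (catRate * n) * |unstableCoord (v - w)| < Real.exp (-α * n) := by
      linarith [Real.exp_pos (-α * n)]
    have e : Real.exp (-α * n) = Real.exp (catRate * n) * Real.exp (-((α + catRate) * n)) := by
      rw [← Real.exp_add]; congr 1; ring
    rw [e] at h'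
    exact lt_of_mul_lt_mul_left h' (Real.exp_pos _).le
  · rcases max_choice 0 (α - catRate) with h | h <;> rw [h]
    · simpa using hs 0 n.zero_le
    · exact hs n le_rfl

theorem eq_of_abs_natCast_mul_sub_lt {i j : ℕ} {δ : ℝ} (hδ : 0 < δ)
    (h : |(i : ℝ) * δ - j * δ| < δ) : i = j := by
  rw [← sub_mul, abs_mul, abs_of_pos hδ] at h
  have h1 : |(i : ℝ) - j| < 1 := by
    by_contra! h'
    nlinarith
  have h2 : |(i : ℤ) - j| < 1 := by exact_mod_cast h1
  have := Int.abs_lt_one_iff.mp h2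
  omega

theorem mem_range_floor_mul_le {i : ℕ} {δ : ℝ} (hδ : 0 < δ)
    (hi : i ∈ Finset.range (⌊1 / 16 / δ⌋₊ + 1)) : (i : ℝ) * δ ≤ 1 / 16 := by
  rw [← le_div_iff₀ hδ]
  exact (Nat.le_floor_iff (by positivity)).mp (Nat.lt_succ_iff.mp (Finset.mem_range.mp hi))

theorem le_card_range_floor (x : ℝ) :
    1 / 16 * Real.exp x ≤ (Finset.range (⌊1 / 16 / Real.exp (-x)⌋₊ + 1)).card := by
  have h := (Nat.lt_floor_add_one (1 / 16 / Real.exp (-x))).le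
  rw [Finset.card_range]
  push_cast
  rwa [Real.exp_neg, div_inv_eq_mul] at h ⊢

/-- Every spanning set of scale `1 / 32` is large. -/
theorem le_card_of_spanning
    (hdT : ∀ v w : EuclideanSpace ℝ (Fin 2),
      dT ↑v ↑w = ⨅ n : intLattice, ‖v - w + (n : EuclideanSpace ℝ (Fin 2))‖)
    (hfA : ∀ v : EuclideanSpace ℝ (Fin 2), fA ↑v = ↑(catMap v))
    {α : ℝ} (hα : 0 ≤ α) (n : ℕ) (S : Finset Torus2)
    (hS : ∀ x, ∃ y ∈ S, ∀ t : ℕ, t ≤ n →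
      dT (fA^[t] x) (fA^[t] y) < 1 / 32 * Real.exp (-α * t)) :
    1 / 256 * Real.exp ((α + catRate + max 0 (α - catRate)) * n) ≤ S.card := by
  choose g hgS hg using hS
  set δu := Real.exp (-((α + catRate) * n)) with hδu
  set δs := Real.exp (-(max 0 (α - catRate) * n)) with hδs
  have hδu0 : 0 < δu := Real.exp_pos _
  have hδs0 : 0 < δs := Real.exp_pos _
  let I := Finset.range (⌊1 / 16 / δu⌋₊ + 1)
  let J := Finset.range (⌊1 / 16 / δs⌋₊ + 1)
  have hcard : (I ×ˢ J).card ≤ S.card := by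
    refine Finset.card_le_card_of_injOn
      (fun p => g (ofCoords (p.1 * δu) (p.2 * δs) : Torus2)) (fun p _ => hgS _) ?_
    rintro ⟨i, j⟩ hij ⟨k, l⟩ hkl heq
    simp only [Finset.coe_product, Set.mem_prod, Finset.mem_coe] at hij hkl heq
    have hi := mem_range_floor_mul_le hδu0 hij.1
    have hj := mem_range_floor_mul_le hδs0 hij.2
    have hk := mem_range_floor_mul_le hδu0 hkl.1
    have hl := mem_range_floor_mul_le hδs0 hkl.2
    have hdist : ‖ofCoords (i * δu) (j * δs) - ofCoords (k * δu) (l * δs)‖ < 1 / 2 := by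
      refine (norm_le_coords _).trans_lt ?_
      rw [unstableCoord_sub, stableCoord_sub, unstableCoord_ofCoords, unstableCoord_ofCoords,
        stableCoord_ofCoords, stableCoord_ofCoords]
      have h1 : |(i : ℝ) * δu - k * δu| ≤ 1 / 16 :=
        abs_sub_le_of_nonneg_of_le (by positivity) hi (by positivity) hk
      have h2 : |(j : ℝ) * δs - l * δs| ≤ 1 / 16 :=
        abs_sub_le_of_nonneg_of_le (by positivity) hj (by positivity) hl
      linarith
    have h := coords_lt_of_shadowed hdT hfA hα hdist (hg _) (heq ▸ hg _)
    rw [unstableCoord_ofCoords, unstableCoord_ofCoords, stableCoord_ofCoords,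
      stableCoord_ofCoords] at h
    rw [eq_of_abs_natCast_mul_sub_lt hδu0 h.1, eq_of_abs_natCast_mul_sub_lt hδs0 h.2]
  calc _ = (1 / 16 * Real.exp ((α + catRate) * n)) *
        (1 / 16 * Real.exp (max 0 (α - catRate) * n)) := by
        rw [add_mul _ (max 0 (α - catRate)), Real.exp_add]; ring
    _ ≤ (I.card : ℝ) * J.card := by
        gcongr
        · exact le_card_range_floor _
        · exact le_card_range_floor _
    _ ≤ S.card := by
        rw [Finset.card_product] at hcard
        exact_mod_cast hcard

end Torus

theorem tendsto_const_add_mul_div (c h : ℝ) :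
    Tendsto (fun n : ℕ => (((c + h * n) / n : ℝ) : EReal)) atTop (nhds (h : EReal)) := by
  apply (continuous_coe_real_ereal.tendsto h).comp
  have h1 : Tendsto (fun n : ℕ => c / (n : ℝ) + h) atTop (nhds (0 + h)) :=
    (tendsto_const_div_atTop_nhds_zero_nat c).add_const h
  rw [zero_add] at h1
  refine h1.congr' ?_
  filter_upwards [eventually_ne_atTop 0] with n hn
  have : (n : ℝ) ≠ 0 := by exact_mod_cast hn
  field_simp

/-- Exponential bounds on the spanning numbers determine the estimation entropy. -/
theorem estEntropyD_eq_of_bounds {X : Type*} {d : X → X → ℝ} {g : X → X} {K : Set X} {α h : ℝ}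
    (hh : 0 ≤ h)
    (hub : ∀ ε > 0, ∃ C ≥ (1 : ℝ), ∀ n : ℕ, (spanNumD d g K α n ε : ℝ) ≤ C * Real.exp (h * n))
    (hlb : ∃ ε > 0, ∃ c > 0, ∀ n : ℕ, c * Real.exp (h * n) ≤ spanNumD d g K α n ε) :
    estEntropyD d g K α = (h : EReal) := by
  apply le_antisymm
  · refine iSup₂_le fun ε hε => ?_
    obtain ⟨C, hC, hb⟩ := hub ε hε
    rw [← (tendsto_const_add_mul_div (Real.log C) h).limsup_eq]
    refine limsup_le_limsup (Eventually.of_forall fun n => ?_)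
    rw [EReal.coe_le_coe_iff]
    gcongr
    have hC0 : 0 < C := by linarith
    rcases Nat.eq_zero_or_pos (spanNumD d g K α n ε) with h0 | h0
    · rw [h0, Nat.cast_zero, Real.log_zero]
      have := Real.log_nonneg hC
      positivity
    · rw [← Real.log_exp (h * n), ← Real.log_mul hC0.ne' (Real.exp_pos _).ne']
      exact Real.log_le_log (by exact_mod_cast h0) (hb n)
  · obtain ⟨ε, hε, c, hc, hb⟩ := hlb
    refine le_trans ?_ (le_iSup₂ (f := fun ε (_ : ε ∈ Set.Ioi (0 : ℝ)) => atTop.limsup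
      fun n : ℕ => ((Real.log (spanNumD d g K α n ε) / n : ℝ) : EReal)) ε hε)
    rw [← (tendsto_const_add_mul_div (Real.log c) h).limsup_eq]
    refine limsup_le_limsup (Eventually.of_forall fun n => ?_)
    rw [EReal.coe_le_coe_iff]
    gcongr
    rw [← Real.log_exp (h * n), ← Real.log_mul hc.ne' (Real.exp_pos _).ne']
    exact Real.log_le_log (by positivity) (hb n)

theorem estEntropyD_torus_eq_max {dT : Torus2 → Torus2 → ℝ} {fA : Torus2 → Torus2}
    (hdT : ∀ v w : EuclideanSpace ℝ (Fin 2),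
      dT ↑v ↑w = ⨅ n : intLattice, ‖v - w + (n : EuclideanSpace ℝ (Fin 2))‖)
    (hfA : ∀ v : EuclideanSpace ℝ (Fin 2), fA ↑v = ↑(catMap v))
    {α : ℝ} (hα : 0 ≤ α) :
    estEntropyD dT fA Set.univ α = ((α + catRate + max 0 (α - catRate) : ℝ) : EReal) := by
  have hL := catRate_pos
  have hβ := le_max_left 0 (α - catRate)
  have hαβ := le_max_right 0 (α - catRate)
  refine estEntropyD_eq_of_bounds (by positivity) (fun ε hε => ?_) ?_
  · refine ⟨(6 / (ε / 8) + 3) ^ 2, one_le_pow₀ ?_, fun n => ?_⟩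
    · have : 0 < 6 / (ε / 8) := by positivity
      linarith
    · obtain ⟨S, hcard, hS⟩ := exists_spanning_finset hdT hfA hα hβ hαβ hε n
      refine le_trans ?_ hcard
      rw [Nat.cast_le]
      exact Nat.sInf_le ⟨S, Set.subset_univ _, rfl, fun x _ => hS x⟩
  · refine ⟨1 / 32, by norm_num, 1 / 256, by norm_num, fun n => ?_⟩
    obtain ⟨S₀, -, hS₀⟩ := exists_spanning_finset hdT hfA hα hβ hαβ
      (by norm_num : (0 : ℝ) < 1 / 32) n
    obtain ⟨S, -, hcard, hS⟩ := Nat.sInf_mem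
      (s := {m : ℕ | ∃ S : Finset Torus2, (S : Set Torus2) ⊆ Set.univ ∧ S.card = m ∧
        ∀ x ∈ Set.univ, ∃ y ∈ S, ∀ t : ℕ, t ≤ n →
          dT (fA^[t] x) (fA^[t] y) < 1 / 32 * Real.exp (-α * t)})
      ⟨_, S₀, Set.subset_univ _, rfl, fun x _ => hS₀ x⟩
    rw [spanNumD, ← hcard]
    exact le_card_of_spanning hdT hfA hα n S fun x => hS x (Set.mem_univ x)

/-- Let `𝕋² = ℝ²/ℤ²` carry the flat metric
`d(x+ℤ², y+ℤ²) = min_{n∈ℤ²} ‖x−y+n‖` and let `f_A` be the automorphism of `𝕋²`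
induced by `A = [[2,1],[1,1]]`. With `γ = (3+√5)/2`, for every `α ≥ 0` the estimation
entropy (natural logarithm) satisfies `h_est(α,𝕋²;f_A) = α + ln γ` if
`0 ≤ α ≤ ln γ`, and `h_est(α,𝕋²;f_A) = 2α` if `α ≥ ln γ`. -/
theorem estEntropy_torus_cat_map
    (dT : Torus2 → Torus2 → ℝ)
    (hdT : ∀ v w : EuclideanSpace ℝ (Fin 2),
      dT ↑v ↑w = ⨅ n : intLattice, ‖v - w + (n : EuclideanSpace ℝ (Fin 2))‖)
    (fA : Torus2 → Torus2)
    (hfA : ∀ v : EuclideanSpace ℝ (Fin 2), fA ↑v = ↑(catMap v))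
    (α : ℝ) (hα : 0 ≤ α) :
    (α ≤ Real.log ((3 + Real.sqrt 5) / 2) →
      estEntropyD dT fA Set.univ α
        = ((α + Real.log ((3 + Real.sqrt 5) / 2) : ℝ) : EReal)) ∧
    (Real.log ((3 + Real.sqrt 5) / 2) ≤ α →
      estEntropyD dT fA Set.univ α = ((2 * α : ℝ) : EReal)) := by
  have h := estEntropyD_torus_eq_max hdT hfA hα
  refine ⟨fun hle => ?_, fun hle => ?_⟩
  · rw [h, catRate, max_eq_left (sub_nonpos.mpr hle), add_zero]
  · rw [h, catRate, max_eq_right (sub_nonneg.mpr hle)]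
    congr 1
    ring
end
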